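/- arXiv:2106.13350 — 8 statements merged into one kernel-verified Lean document; each statement's English description precedes it below -/
import Mathlib

section
/- A random attention rule μ_r for a fixed reference r ∈ X has an IRA (Independent Random Attention) representation if and only if it has both an LRA (Luce Random Attention) representation and a CRA (Constant Random Attention) representation. -/
open Finset
open scoped Classical

namespace RDRAM

noncomputable section

variable {α : Type*} [Fintype α] [DecidableEq α]

/-- `x` is the `R`-maximum of `D`. -/
def IsMaxOf (R : α → α → Prop) (x : α) (D : Finset α) : Prop :=
  x ∈ D ∧ ∀ y ∈ D, R x y

/-- `R` is a linear order: complete, antisymmetric, transitive. -/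
structure LinOrd (R : α → α → Prop) : Prop where
  total : ∀ x y, R x y ∨ R y x
  antisymm : ∀ x y, R x y → R y x → x = y
  trans : ∀ x y z, R x y → R y z → R x z

/-- A reference-dependent random choice rule `p r x S`. -/
structure IsRandomChoiceRule (p : α → α → Finset α → ℝ) : Prop where
  nonneg : ∀ r x S, 0 ≤ p r x S
  support : ∀ r x (S : Finset α), S.Nonempty → r ∈ S → 0 < p r x S → x ∈ S
  sum_one : ∀ r (S : Finset α), S.Nonempty → r ∈ S → ∑ x ∈ S, p r x S = 1

/-- A stochastic choice rule `q x S` (no reference). -/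
structure IsStochasticChoiceRule (q : α → Finset α → ℝ) : Prop where
  nonneg : ∀ x S, 0 ≤ q x S
  support : ∀ x (S : Finset α), S.Nonempty → 0 < q x S → x ∈ S
  sum_one : ∀ S : Finset α, S.Nonempty → ∑ x ∈ S, q x S = 1

/-- A random attention rule `μ D S` for reference `r`. -/
structure IsAttentionRule (r : α) (μ : Finset α → Finset α → ℝ) : Prop where
  nonneg : ∀ D S, 0 ≤ μ D S
  support : ∀ (S D : Finset α), S.Nonempty → r ∈ S → 0 < μ D S → r ∈ D ∧ D ⊆ S
  sum_one : ∀ (S : Finset α), S.Nonempty → r ∈ S → ∑ D ∈ S.powerset, μ D S = 1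

/-- Full support: every admissible consideration set has positive probability. -/
def FullSupport (r : α) (μ : Finset α → Finset α → ℝ) : Prop :=
  ∀ (S D : Finset α), S.Nonempty → r ∈ S → r ∈ D → D ⊆ S → 0 < μ D S

/-- `(R, μ)` is an RD-RAM representation of `p`. -/
def IsRDRAMRep (p : α → α → Finset α → ℝ) (R : α → α → Prop)
    (μ : α → Finset α → Finset α → ℝ) : Prop :=
  LinOrd R ∧ (∀ r, IsAttentionRule r (μ r) ∧ FullSupport r (μ r)) ∧
    ∀ r (S : Finset α), S.Nonempty → r ∈ S → ∀ x ∈ S,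
      p r x S = ∑ D ∈ S.powerset.filter (fun D => r ∈ D ∧ IsMaxOf R x D), μ r D S

/-- Independent Random Attention representation of an attention rule. -/
def HasIRA (r : α) (μ : Finset α → Finset α → ℝ) : Prop :=
  ∃ γ : α → ℝ, γ r = 1 ∧ (∀ x, x ≠ r → 0 < γ x ∧ γ x < 1) ∧
    ∀ (S : Finset α), S.Nonempty → r ∈ S → ∀ D : Finset α, r ∈ D → D ⊆ S →
      μ D S = (∏ x ∈ D, γ x) * ∏ y ∈ S \ D, (1 - γ y)

/-- Luce Random Attention representation of an attention rule. -/
def HasLRA (r : α) (μ : Finset α → Finset α → ℝ) : Prop :=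
  ∃ π : Finset α → ℝ, (∀ D : Finset α, r ∈ D → 0 < π D) ∧
    (∑ D ∈ (univ : Finset α).powerset.filter (fun D => r ∈ D), π D = 1) ∧
    ∀ (S : Finset α), S.Nonempty → r ∈ S → ∀ D : Finset α, r ∈ D → D ⊆ S →
      μ D S = π D / ∑ D' ∈ S.powerset.filter (fun D' => r ∈ D'), π D'

/-- Constant Random Attention representation of an attention rule. -/
def HasCRA (r : α) (μ : Finset α → Finset α → ℝ) : Prop :=
  ∃ π : Finset α → ℝ, (∀ D : Finset α, r ∈ D → 0 < π D) ∧
    (∑ D ∈ (univ : Finset α).powerset.filter (fun D => r ∈ D), π D = 1) ∧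
    ∀ (S : Finset α), S.Nonempty → r ∈ S → ∀ D : Finset α, r ∈ D → D ⊆ S →
      μ D S = ∑ D' ∈ (univ : Finset α).powerset.filter (fun D' => D' ∩ S = D), π D'

/-- `p` has an IRA representation. -/
def HasIRARep (p : α → α → Finset α → ℝ) : Prop :=
  ∃ (R : α → α → Prop) (μ : α → Finset α → Finset α → ℝ),
    IsRDRAMRep p R μ ∧ ∀ r, HasIRA r (μ r)

/-- `p` has an LRA representation. -/
def HasLRARep (p : α → α → Finset α → ℝ) : Prop :=
  ∃ (R : α → α → Prop) (μ : α → Finset α → Finset α → ℝ),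
    IsRDRAMRep p R μ ∧ ∀ r, HasLRA r (μ r)

/-- `p` has a CRA representation. -/
def HasCRARep (p : α → α → Finset α → ℝ) : Prop :=
  ∃ (R : α → α → Prop) (μ : α → Finset α → Finset α → ℝ),
    IsRDRAMRep p R μ ∧ ∀ r, HasCRA r (μ r)

/-- No-Cycle Condition. -/
def NCC (p : α → α → Finset α → ℝ) : Prop :=
  ∀ (n : ℕ) (x : Fin (n + 1) → α) (Sq : Fin (n + 1) → Finset α),
    (∀ i, (Sq i).Nonempty ∧ x i ∈ Sq i) →
    (∀ i : Fin n, x i.succ ∈ Sq i.castSucc ∧ x i.succ ≠ x i.castSucc ∧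
      0 < p (x i.castSucc) (x i.succ) (Sq i.castSucc)) →
    x 0 ∈ Sq (Fin.last n) → x 0 ≠ x (Fin.last n) →
    p (x (Fin.last n)) (x 0) (Sq (Fin.last n)) = 0

/-- Status Quo Asymmetry. -/
def SQA (p : α → α → Finset α → ℝ) : Prop :=
  ∀ x y : α, x ≠ y → ∀ S T : Finset α, x ∈ S → y ∈ S → x ∈ T → y ∈ T →
    p y x S = 0 → 0 < p x y T

/-- Nontrivial Reference Effect. -/
def NRE (p : α → α → Finset α → ℝ) : Prop :=
  ∀ x (S : Finset α), x ∈ S → 0 < p x x S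

/-- Irrelevance of Dominated Alternatives. -/
def IDA (p : α → α → Finset α → ℝ) : Prop :=
  ∀ r (S : Finset α), S.Nonempty → r ∈ S → ∀ x ∈ S, ∀ y ∈ S, y ≠ r → y ≠ x →
    (∃ T : Finset α, x ∈ T ∧ y ∈ T ∧ 0 < p y x T) →
    p r x S = p r x (S.erase y)

/-- Ratio Independence of Dominant Alternatives. -/
def RIDA (p : α → α → Finset α → ℝ) : Prop :=
  ∀ r (S : Finset α), S.Nonempty → r ∈ S → ∀ x ∈ S, x ≠ r →
    ∀ y ∈ S, y ≠ x → ∀ z ∈ S, z ≠ x →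
      p x x S = 1 → 0 < p r y S * p r z S →
      p r y S / p r z S = p r y (S.erase x) / p r z (S.erase x)

/-- `Pset p r`: the set of alternatives that dominate `r`. -/
def Pset (p : α → α → Finset α → ℝ) (r : α) : Finset α :=
  univ.filter (fun s => s ≠ r ∧ ∃ T : Finset α, r ∈ T ∧ s ∈ T ∧ 0 < p r s T)

/-- Odds against the reference alternative. -/
def odds (p : α → α → Finset α → ℝ) (r : α) (S : Finset α) : ℝ :=
  (1 - p r r S) / p r r S

/-- Decreasing Odds for the Reference Alternative. -/
def DORA (p : α → α → Finset α → ℝ) : Prop :=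
  ∀ r (S : Finset α), S.Nonempty → r ∈ S → ∀ (n : ℕ) (U : Fin n → Finset α),
    (∀ i, U i ⊆ Pset p r ∧ (S ∩ U i).Nonempty) →
    0 < ∑ I ∈ (univ : Finset (Fin n)).powerset,
      (-1 : ℝ) ^ I.card * odds p r (S \ I.biUnion U)

/-- Decreasing Propensity of Choice for the Reference Alternative. -/
def DPCRA (p : α → α → Finset α → ℝ) : Prop :=
  ∀ r (S : Finset α), S.Nonempty → r ∈ S → ∀ (n : ℕ) (U : Fin n → Finset α),
    (∀ i, U i ⊆ Pset p r ∧ (S ∩ U i).Nonempty) →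
    0 < ∑ I ∈ (univ : Finset (Fin n)).powerset,
      (-1 : ℝ) ^ (n - I.card) * p r r (S \ I.biUnion U)

/-- Reference-independent CRA representation of a family of attention rules. -/
def RefIndepCRA (μ : α → Finset α → Finset α → ℝ) : Prop :=
  ∃ π : Finset α → ℝ, π ∅ = 0 ∧ (∀ D : Finset α, D.Nonempty → 0 < π D) ∧
    (∑ D ∈ (univ : Finset α).powerset, π D = 1) ∧
    ∀ r (S : Finset α), S.Nonempty → r ∈ S → ∀ D : Finset α, r ∈ D → D ⊆ S →
      μ r D S = ∑ D' ∈ (univ : Finset α).powerset.filter (fun D' => D' ∩ S = D),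
        (π D' + π (D'.erase r))

/-- The monotonicity property of Cattaneo et al. (2020). -/
def MonotonicAttention (r : α) (μ : Finset α → Finset α → ℝ) : Prop :=
  ∀ D S T : Finset α, r ∈ D → D ⊆ S → S ⊆ T → μ D T ≤ μ D S

/-- `(R, γ)` is an IRA representation of `p` (directly, in terms of attention maps). -/
def IsIRAPair (p : α → α → Finset α → ℝ) (R : α → α → Prop) (γ : α → α → ℝ) : Prop :=
  LinOrd R ∧ (∀ r, γ r r = 1 ∧ ∀ x, x ≠ r → 0 < γ r x ∧ γ r x < 1) ∧
    ∀ r (S : Finset α), S.Nonempty → r ∈ S → ∀ x ∈ S,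
      p r x S = ∑ D ∈ S.powerset.filter (fun D => r ∈ D ∧ IsMaxOf R x D),
        ((∏ a ∈ D, γ r a) * ∏ b ∈ S \ D, (1 - γ r b))

/-- The probability that independent attention with parameters `γ` considers exactly `D` in `S`. -/
def indepWeight (γ : α → ℝ) (S D : Finset α) : ℝ :=
  (∏ x ∈ D, γ x) * ∏ y ∈ S \ D, (1 - γ y)

omit [Fintype α] in
lemma sum_powerset_indepWeight (γ : α → ℝ) (S : Finset α) :
    ∑ D ∈ S.powerset, indepWeight γ S D = 1 := by
  have h := Finset.prod_add γ (fun x => 1 - γ x) S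
  simp only [add_sub_cancel, Finset.prod_const_one] at h
  exact h.symm

omit [Fintype α] in
lemma sum_filter_indepWeight {γ : α → ℝ} {r : α} (hr : γ r = 1) {S : Finset α} (hS : r ∈ S) :
    ∑ D ∈ S.powerset.filter (fun D => r ∈ D), indepWeight γ S D = 1 := by
  rw [← sum_powerset_indepWeight γ S]
  refine Finset.sum_subset (Finset.filter_subset _ _) fun D hD hD' => ?_
  have hrD : r ∉ D := fun h => hD' (Finset.mem_filter.2 ⟨hD, h⟩)
  rw [indepWeight, Finset.prod_eq_zero (Finset.mem_sdiff.2 ⟨hS, hrD⟩) (by simp [hr]), mul_zero]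

omit [Fintype α] in
lemma indepWeight_pos {γ : α → ℝ} {r : α} (hr : γ r = 1)
    (hγ : ∀ x, x ≠ r → 0 < γ x ∧ γ x < 1) {S D : Finset α} (hD : r ∈ D) :
    0 < indepWeight γ S D := by
  refine mul_pos (Finset.prod_pos fun x _ => ?_) (Finset.prod_pos fun y hy => ?_)
  · by_cases hx : x = r
    · simp [hx, hr]
    · exact (hγ x hx).1
  · have hyr : y ≠ r := fun h => (Finset.mem_sdiff.1 hy).2 (h ▸ hD)
    exact sub_pos.2 (hγ y hyr).2

omit [Fintype α] in
lemma indepWeight_union (γ : α → ℝ) {S T D E : Finset α} (hST : Disjoint S T)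
    (hD : D ⊆ S) (hE : E ⊆ T) :
    indepWeight γ (S ∪ T) (D ∪ E) = indepWeight γ S D * indepWeight γ T E := by
  have hDE : Disjoint D E := hST.mono hD hE
  have hsd : (S ∪ T) \ (D ∪ E) = (S \ D) ∪ (T \ E) := by
    ext x
    have h1 : x ∈ S → x ∉ T := fun h => Finset.disjoint_left.1 hST h
    have h2 : x ∈ D → x ∈ S := fun h => hD h
    have h3 : x ∈ E → x ∈ T := fun h => hE h
    simp only [Finset.mem_sdiff, Finset.mem_union]
    tauto
  have hd : Disjoint (S \ D) (T \ E) := hST.mono Finset.sdiff_subset Finset.sdiff_subset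
  rw [indepWeight, indepWeight, indepWeight, hsd, Finset.prod_union hDE, Finset.prod_union hd]
  ring

lemma indepWeight_univ (γ : α → ℝ) {S D : Finset α} (hD : D ⊆ S) :
    indepWeight γ univ D = indepWeight γ S D * indepWeight γ Sᶜ ∅ := by
  simpa using indepWeight_union γ (disjoint_compl_right (a := S)) hD (Finset.empty_subset Sᶜ)

omit [Fintype α] in
lemma indepWeight_insert (γ : α → ℝ) {S D : Finset α} {z : α} (hzS : z ∈ S) (hzD : z ∉ D) :
    indepWeight γ S (insert z D) * (1 - γ z) = indepWeight γ S D * γ z := by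
  have h : S \ D = insert z (S \ insert z D) := by
    ext x
    by_cases hx : x = z <;> simp [hx, hzS, hzD]
  rw [indepWeight, indepWeight, h, Finset.prod_insert hzD,
    Finset.prod_insert (by simp)]
  ring

/-- Normalizing the independent weights of subsets of a menu recovers independent attention. -/
lemma indepWeight_univ_div_sum {γ : α → ℝ} {r : α} (hr : γ r = 1)
    (hγ : ∀ x, x ≠ r → 0 < γ x ∧ γ x < 1) {S D : Finset α} (hS : r ∈ S) (hD : D ⊆ S) :
    indepWeight γ univ D /
      ∑ D' ∈ S.powerset.filter (fun D' => r ∈ D'), indepWeight γ univ D' =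
      indepWeight γ S D := by
  have hc : indepWeight γ Sᶜ ∅ ≠ 0 := by
    have h := indepWeight_pos hr hγ (S := univ) hS
    rw [indepWeight_univ γ (Finset.Subset.refl S)] at h
    exact right_ne_zero_of_mul h.ne'
  have hsum : ∑ D' ∈ S.powerset.filter (fun D' => r ∈ D'), indepWeight γ univ D' =
      indepWeight γ Sᶜ ∅ := by
    rw [Finset.sum_congr rfl fun D' hD' => indepWeight_univ γ
      (Finset.mem_powerset.1 (Finset.mem_filter.1 hD').1), ← Finset.sum_mul,
      sum_filter_indepWeight hr hS, one_mul]
  rw [hsum, indepWeight_univ γ hD, mul_div_cancel_right₀ _ hc]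

/-- Independent attention in a menu is the marginal of independent attention in the full set. -/
lemma sum_inter_eq_indepWeight (γ : α → ℝ) {S D : Finset α} (hD : D ⊆ S) :
    ∑ D' ∈ (univ : Finset α).powerset.filter (fun D' => D' ∩ S = D), indepWeight γ univ D' =
      indepWeight γ S D := by
  rw [← mul_one (indepWeight γ S D), ← sum_powerset_indepWeight γ Sᶜ, Finset.mul_sum]
  refine Finset.sum_nbij' (fun D' => D' \ S) (fun E => D ∪ E) ?_ ?_ ?_ ?_ ?_
  · intro D' _
    rw [Finset.mem_powerset]
    intro x hx
    exact Finset.mem_compl.2 (Finset.mem_sdiff.1 hx).2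
  · intro E hE
    have hES : Disjoint E S :=
      (disjoint_compl_left (a := S)).mono_left (Finset.mem_powerset.1 hE)
    simp [Finset.union_inter_distrib_right, Finset.inter_eq_left.2 hD,
      Finset.disjoint_iff_inter_eq_empty.1 hES]
  · intro D' h
    rw [← (Finset.mem_filter.1 h).2, Finset.union_comm, Finset.sdiff_union_inter]
  · intro E hE
    have hES : Disjoint E S :=
      (disjoint_compl_left (a := S)).mono_left (Finset.mem_powerset.1 hE)
    rw [Finset.union_sdiff_distrib, Finset.sdiff_eq_empty_iff_subset.2 hD,
      Finset.sdiff_eq_self_of_disjoint hES, Finset.empty_union]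
  · intro D' h
    have h' := (Finset.mem_filter.1 h).2
    have hsub : D' \ S ⊆ Sᶜ := fun x hx => Finset.mem_compl.2 (Finset.mem_sdiff.1 hx).2
    have hu : D ∪ D' \ S = D' := by
      rw [← h', Finset.union_comm, Finset.sdiff_union_inter]
    rw [← indepWeight_union γ disjoint_compl_right hD hsub, hu, Finset.union_compl]

/-- Positive weights on the sets containing `r` that sum to one and have the odds `γ z / (1 - γ z)`
for including each `z ≠ r` are the independent weights. -/
lemma eq_indepWeight_of_insert {γ : α → ℝ} {r : α} {π : Finset α → ℝ} (hr : γ r = 1)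
    (hγ : ∀ x, x ≠ r → 0 < γ x ∧ γ x < 1)
    (hsum : ∑ D ∈ (univ : Finset α).powerset.filter (fun D => r ∈ D), π D = 1)
    (hins : ∀ z, z ≠ r → ∀ D : Finset α, r ∈ D → z ∉ D → π (insert z D) * (1 - γ z) = π D * γ z)
    {D : Finset α} (hD : r ∈ D) : π D = indepWeight γ univ D := by
  have key : ∀ E : Finset α, r ∉ E → π (insert r E) * indepWeight γ univ {r} =
      indepWeight γ univ (insert r E) * π {r} := by
    intro E
    induction E using Finset.induction_on with
    | empty => intro _; simp [mul_comm]
    | insert z E hz ih =>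
      intro hE
      have hzr : z ≠ r := fun h => hE (by simp [h])
      have hrE : r ∉ E := fun h => hE (Finset.mem_insert_of_mem h)
      have hzE : z ∉ insert r E := by simp [hzr, hz]
      have h1 := hins z hzr (insert r E) (Finset.mem_insert_self _ _) hzE
      have h2 := indepWeight_insert γ (Finset.mem_univ z) hzE
      have h0 : (1 - γ z) ≠ 0 := (sub_pos.2 (hγ z hzr).2).ne'
      rw [Finset.insert_comm r z E]
      apply mul_right_cancel₀ h0
      linear_combination indepWeight γ univ {r} * h1 + γ z * ih hrE - π {r} * h2
  have key' : ∀ D : Finset α, r ∈ D →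
      π D * indepWeight γ univ {r} = indepWeight γ univ D * π {r} := fun D hD => by
    simpa [Finset.insert_erase hD] using key (D.erase r) (Finset.notMem_erase r D)
  have hc : indepWeight γ univ {r} = π {r} := by
    have h := Finset.sum_congr rfl fun D (hD : D ∈ (univ : Finset α).powerset.filter
      (fun D => r ∈ D)) => key' D (Finset.mem_filter.1 hD).2
    rwa [← Finset.sum_mul, ← Finset.sum_mul, hsum,
      sum_filter_indepWeight hr (Finset.mem_univ r), one_mul, one_mul] at h
  have hpos : indepWeight γ univ {r} ≠ 0 :=
    (indepWeight_pos hr hγ (Finset.mem_singleton_self r)).ne'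
  have h := key' D hD
  rw [← hc] at h
  exact mul_right_cancel₀ hpos h

lemma filter_inter_erase_eq {D : Finset α} {z : α} (hz : z ∉ D) :
    (univ : Finset α).powerset.filter (fun D' => D' ∩ univ.erase z = D) = {D, insert z D} := by
  ext D'
  have h : D' ∩ univ.erase z = D'.erase z := by
    rw [Finset.inter_erase, Finset.inter_univ]
  simp only [Finset.powerset_univ, Finset.mem_filter, Finset.mem_univ, true_and, h,
    Finset.mem_insert, Finset.mem_singleton]
  constructor
  · rintro rfl
    by_cases hz' : z ∈ D'
    · exact Or.inr (Finset.insert_erase hz').symm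
    · exact Or.inl (Finset.erase_eq_of_notMem hz').symm
  · rintro (rfl | rfl)
    · exact Finset.erase_eq_of_notMem hz
    · exact Finset.erase_insert hz

lemma HasIRA.hasLRA {r : α} {μ : Finset α → Finset α → ℝ} (h : HasIRA r μ) : HasLRA r μ := by
  obtain ⟨γ, hr, hγ, hμ⟩ := h
  refine ⟨indepWeight γ univ, fun D hD => indepWeight_pos hr hγ hD,
    sum_filter_indepWeight hr (Finset.mem_univ r), fun S hS hrS D hrD hD => ?_⟩
  rw [indepWeight_univ_div_sum hr hγ hrS hD]
  exact hμ S hS hrS D hrD hD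

lemma HasIRA.hasCRA {r : α} {μ : Finset α → Finset α → ℝ} (h : HasIRA r μ) : HasCRA r μ := by
  obtain ⟨γ, hr, hγ, hμ⟩ := h
  refine ⟨indepWeight γ univ, fun D hD => indepWeight_pos hr hγ hD,
    sum_filter_indepWeight hr (Finset.mem_univ r), fun S hS hrS D hrD hD => ?_⟩
  rw [sum_inter_eq_indepWeight γ hD]
  exact hμ S hS hrS D hrD hD

lemma HasLRA.hasIRA {r : α} {μ : Finset α → Finset α → ℝ} (hL : HasLRA r μ)
    (hC : HasCRA r μ) : HasIRA r μ := by
  obtain ⟨π, hπ, hsum, hμ⟩ := hL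
  obtain ⟨π', -, -, hμ'⟩ := hC
  have hπ' : ∀ D, r ∈ D → π' D = π D := fun D hD => by
    have h1 := hμ univ ⟨r, Finset.mem_univ r⟩ (Finset.mem_univ r) D hD (Finset.subset_univ D)
    have h2 := hμ' univ ⟨r, Finset.mem_univ r⟩ (Finset.mem_univ r) D hD (Finset.subset_univ D)
    rw [hsum, div_one] at h1
    rw [← h1, h2]
    simp [Finset.filter_eq']
  set Z : α → ℝ := fun z => ∑ D ∈ (univ.erase z).powerset.filter (fun D => r ∈ D), π D
  have hZpos : ∀ z, z ≠ r → 0 < Z z := fun z hz => by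
    refine Finset.sum_pos (fun D hD => hπ D (Finset.mem_filter.1 hD).2) ⟨{r}, ?_⟩
    simp [hz.symm]
  have hadd : ∀ z, z ≠ r → ∀ D : Finset α, r ∈ D → z ∉ D →
      π (insert z D) * Z z = π D * (1 - Z z) := fun z hz D hrD hzD => by
    have hr : r ∈ univ.erase z := by simp [hz.symm]
    have hsub : D ⊆ univ.erase z := fun x hx =>
      Finset.mem_erase.2 ⟨fun h => hzD (h ▸ hx), Finset.mem_univ x⟩
    have h1 := hμ _ ⟨r, hr⟩ hr D hrD hsub
    rw [hμ' _ ⟨r, hr⟩ hr D hrD hsub, filter_inter_erase_eq hzD,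
      Finset.sum_pair (Finset.ne_insert_of_notMem D D hzD), hπ' D hrD,
      hπ' _ (Finset.mem_insert_of_mem hrD), eq_div_iff (hZpos z hz).ne'] at h1
    linear_combination h1
  have hZlt : ∀ z, z ≠ r → Z z < 1 := fun z hz => by
    have hrr := Finset.mem_singleton_self r
    have h := hadd z hz {r} hrr (by simpa using hz)
    have hpos := mul_pos (hπ (insert z {r}) (Finset.mem_insert_of_mem hrr)) (hZpos z hz)
    rw [h] at hpos
    exact sub_pos.1 (pos_of_mul_pos_right hpos (hπ _ hrr).le)
  set γ : α → ℝ := fun z => if z = r then 1 else 1 - Z z with hγdef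
  have hr : γ r = 1 := by simp [hγdef]
  have hγz : ∀ z, z ≠ r → γ z = 1 - Z z := fun z hz => by simp [hγdef, hz]
  have hγ : ∀ z, z ≠ r → 0 < γ z ∧ γ z < 1 := fun z hz => by
    rw [hγz z hz]
    exact ⟨sub_pos.2 (hZlt z hz), sub_lt_self _ (hZpos z hz)⟩
  have hins : ∀ z, z ≠ r → ∀ D : Finset α, r ∈ D → z ∉ D →
      π (insert z D) * (1 - γ z) = π D * γ z := fun z hz D hrD hzD => by
    rw [hγz z hz, sub_sub_cancel]
    exact hadd z hz D hrD hzD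
  refine ⟨γ, hr, hγ, fun S hS hrS D hrD hD => ?_⟩
  rw [hμ S hS hrS D hrD hD, eq_indepWeight_of_insert hr hγ hsum hins hrD,
    Finset.sum_congr rfl fun D' hD' =>
      eq_indepWeight_of_insert hr hγ hsum hins (Finset.mem_filter.1 hD').2]
  exact indepWeight_univ_div_sum hr hγ hrS hD

/-- an attention rule has an IRA representation iff it has both
LRA and CRA representations. -/
theorem ira_iff_lra_and_cra (h2 : 2 ≤ Fintype.card α) (r : α)
    (μ : Finset α → Finset α → ℝ) (hμ : IsAttentionRule r μ) :
    HasIRA r μ ↔ HasLRA r μ ∧ HasCRA r μ := by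
  exact ⟨fun h => ⟨h.hasLRA, h.hasCRA⟩, fun h => h.1.hasIRA h.2⟩

end
end RDRAM
end

section
/- A reference-dependent random choice rule {p_r}_{r∈X} has an RD-RAM representation if and only if it satisfies NCC, SQA, and NRE. -/
open Finset
open scoped Classical

namespace RDRAM

noncomputable section

variable {α : Type*} [Fintype α] [DecidableEq α]

omit [Fintype α] [DecidableEq α] in
theorem LinOrd.refl {R : α → α → Prop} (hR : LinOrd R) (x : α) : R x x :=
  (hR.total x x).elim id id

omit [Fintype α] in
theorem LinOrd.exists_isMaxOf {R : α → α → Prop} (hR : LinOrd R) {D : Finset α}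
    (hD : D.Nonempty) : ∃ x, IsMaxOf R x D := by
  induction hD using Finset.Nonempty.cons_induction with
  | singleton a => exact ⟨a, by simp, by simpa using hR.refl a⟩
  | cons a s ha hs ih =>
    obtain ⟨x, hx, hmax⟩ := ih
    rcases hR.total a x with h | h
    · refine ⟨a, by simp, fun y hy => ?_⟩
      rcases Finset.mem_cons.1 hy with rfl | hy
      · exact hR.refl _
      · exact hR.trans _ _ _ h (hmax y hy)
    · refine ⟨x, by simp [hx], fun y hy => ?_⟩
      rcases Finset.mem_cons.1 hy with rfl | hy
      · exact h
      · exact hmax y hy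

omit [Fintype α] [DecidableEq α] in
theorem LinOrd.isMaxOf_unique {R : α → α → Prop} (hR : LinOrd R) {D : Finset α} {x y : α}
    (hx : IsMaxOf R x D) (hy : IsMaxOf R y D) : x = y :=
  hR.antisymm _ _ (hx.2 y hy.1) (hy.2 x hx.1)

omit [Fintype α] in
theorem LinOrd.isMaxOf_pair {R : α → α → Prop} (hR : LinOrd R) {x r : α} (h : R x r) :
    IsMaxOf R x {x, r} :=
  ⟨by simp, by simp [hR.refl x, h]⟩

omit [Fintype α] in
/-- In an RD-RAM, `x` is chosen with positive probability at reference `r` exactly when `x` is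
weakly preferred to `r`. -/
theorem IsRDRAMRep.pos_iff {p : α → α → Finset α → ℝ} {R : α → α → Prop}
    {μ : α → Finset α → Finset α → ℝ} (h : IsRDRAMRep p R μ) {r x : α} {S : Finset α}
    (hr : r ∈ S) (hx : x ∈ S) : 0 < p r x S ↔ R x r := by
  obtain ⟨hR, hμ, hrep⟩ := h
  rw [hrep r S ⟨r, hr⟩ hr x hx]
  constructor
  · intro hpos
    obtain ⟨D, hD, -⟩ := Finset.exists_ne_zero_of_sum_ne_zero hpos.ne'
    obtain ⟨-, hrD, hmax⟩ := Finset.mem_filter.1 hD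
    exact hmax.2 r hrD
  · intro hxr
    refine Finset.sum_pos' (fun D _ => (hμ r).1.nonneg D S) ⟨{x, r}, ?_, ?_⟩
    · simp [Finset.insert_subset_iff, hr, hx, hR.isMaxOf_pair hxr]
    · exact (hμ r).2 S _ ⟨r, hr⟩ hr (by simp) (by simp [Finset.insert_subset_iff, hr, hx])

omit [Fintype α] in
theorem IsRDRAMRep.ncc {p : α → α → Finset α → ℝ} (hp : IsRandomChoiceRule p)
    {R : α → α → Prop} {μ : α → Finset α → Finset α → ℝ} (h : IsRDRAMRep p R μ) : NCC p := by
  intro n x S hS hstep hmem hne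
  have hchain : ∀ i : Fin (n + 1), R (x i) (x 0) := by
    intro i
    induction i using Fin.induction with
    | zero => exact h.1.refl _
    | succ i ih =>
      obtain ⟨h1, -, h3⟩ := hstep i
      exact h.1.trans _ _ _ ((h.pos_iff (hS _).2 h1).1 h3) ih
  by_contra hzero
  have hpos := lt_of_le_of_ne (hp.nonneg _ _ _) (Ne.symm hzero)
  exact hne (h.1.antisymm _ _ ((h.pos_iff (hS _).2 hmem).1 hpos) (hchain _))

omit [Fintype α] in
theorem IsRDRAMRep.sqa {p : α → α → Finset α → ℝ}
    {R : α → α → Prop} {μ : α → Finset α → Finset α → ℝ} (h : IsRDRAMRep p R μ) : SQA p := by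
  intro x y _ S T hxS hyS hxT hyT hzero
  refine (h.pos_iff hxT hyT).2 ((h.1.total x y).resolve_left fun hxy => ?_)
  exact ((h.pos_iff hyS hxS).2 hxy).ne' hzero

omit [Fintype α] in
theorem IsRDRAMRep.nre {p : α → α → Finset α → ℝ}
    {R : α → α → Prop} {μ : α → Finset α → Finset α → ℝ} (h : IsRDRAMRep p R μ) : NRE p :=
  fun x _ hx => (h.pos_iff hx hx).2 (h.1.refl x)

/-- `x` is revealed weakly preferred to `r`: it is sometimes chosen when `r` is the reference. -/
def Dominates (p : α → α → Finset α → ℝ) (x r : α) : Prop :=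
  ∃ S : Finset α, r ∈ S ∧ x ∈ S ∧ 0 < p r x S

omit [Fintype α] [DecidableEq α] in
theorem NCC.not_dominates_symm {p : α → α → Finset α → ℝ} (hN : NCC p) {x y : α}
    (hne : x ≠ y) (hxy : Dominates p x y) : ¬ Dominates p y x := by
  rintro ⟨T, hxT, hyT, hT⟩
  obtain ⟨S, hyS, hxS, hS⟩ := hxy
  have := hN 1 ![y, x] ![S, T]
    (by simpa [Fin.forall_fin_two] using ⟨⟨⟨y, hyS⟩, hyS⟩, ⟨x, hxT⟩, hxT⟩)
    (by simpa using ⟨hxS, hne, hS⟩) (by simpa using hyT) (by simpa using hne.symm)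
  exact hT.ne' (by simpa using this)

omit [Fintype α] [DecidableEq α] in
theorem NCC.not_dominates_cycle {p : α → α → Finset α → ℝ} (hN : NCC p) {x y z : α}
    (hxy : x ≠ y) (hyz : y ≠ z) (hxz : x ≠ z) (h₁ : Dominates p x y) (h₂ : Dominates p y z) :
    ¬ Dominates p z x := by
  rintro ⟨U, hxU, hzU, hU⟩
  obtain ⟨S, hyS, hxS, hS⟩ := h₁
  obtain ⟨T, hzT, hyT, hT⟩ := h₂
  have := hN 2 ![z, y, x] ![T, S, U]
    (by simpa [Fin.forall_fin_succ] using
      ⟨⟨⟨z, hzT⟩, hzT⟩, ⟨⟨y, hyS⟩, hyS⟩, ⟨x, hxU⟩, hxU⟩)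
    (by simpa [Fin.forall_fin_two] using ⟨⟨hyT, hyz, hT⟩, hxS, hxy, hS⟩)
    (by simpa [Fin.last] using hzU) (by simpa [Fin.last] using hxz.symm)
  exact hU.ne' (by simpa [Fin.last] using this)

omit [Fintype α] in
/-- Under NCC, SQA and NRE, the support of the choice rule does not depend on the menu. -/
theorem pos_iff_dominates {p : α → α → Finset α → ℝ} (hp : IsRandomChoiceRule p) (hN : NCC p)
    (hS : SQA p) (hE : NRE p) {r x : α} {S : Finset α} (hr : r ∈ S) (hx : x ∈ S) :
    0 < p r x S ↔ Dominates p x r := by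
  refine ⟨fun h => ⟨S, hr, hx, h⟩, fun h => ?_⟩
  by_cases hne : x = r
  · exact hne ▸ hE x S hx
  refine lt_of_le_of_ne (hp.nonneg _ _ _) fun hzero => ?_
  exact hN.not_dominates_symm hne h ⟨S, hx, hr, hS x r hne S S hx hr hx hr hzero.symm⟩

omit [Fintype α] in
theorem linOrd_dominates {p : α → α → Finset α → ℝ} (hp : IsRandomChoiceRule p) (hN : NCC p)
    (hS : SQA p) (hE : NRE p) : LinOrd (Dominates p) := by
  have htotal : ∀ x y, Dominates p x y ∨ Dominates p y x := by
    intro x y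
    by_cases hne : x = y
    · exact Or.inl ⟨{x}, by simp [hne], by simp, hne ▸ hE x _ (by simp)⟩
    by_contra! hcon
    have hzero : p y x {x, y} = 0 := by
      by_contra hzero
      exact hcon.1 ⟨{x, y}, by simp, by simp,
        lt_of_le_of_ne (hp.nonneg _ _ _) (Ne.symm hzero)⟩
    exact hcon.2 ⟨{x, y}, by simp, by simp,
      hS x y hne {x, y} {x, y} (by simp) (by simp) (by simp) (by simp) hzero⟩
  refine ⟨htotal, fun x y hxy hyx => ?_, fun x y z hxy hyz => ?_⟩
  · by_contra hne
    exact hN.not_dominates_symm hne hxy hyx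
  · by_cases h₁ : x = y
    · exact h₁ ▸ hyz
    by_cases h₂ : y = z
    · exact h₂ ▸ hxy
    by_cases h₃ : x = z
    · exact h₃ ▸ (htotal x x).elim id id
    exact (htotal x z).resolve_right (hN.not_dominates_cycle h₁ h₂ h₃ hxy hyz)

/-- The consideration sets within `S` that contain `r` and have `R`-maximum `x`. -/
def maxSets (R : α → α → Prop) (r x : α) (S : Finset α) : Finset (Finset α) :=
  S.powerset.filter (fun D => r ∈ D ∧ IsMaxOf R x D)

/-- The attention rule that spreads `p r x S` uniformly over the consideration sets at which `x`
is chosen. -/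
def uniformAttention (p : α → α → Finset α → ℝ) (R : α → α → Prop) (r : α)
    (D S : Finset α) : ℝ :=
  ∑ x ∈ S, if D ∈ maxSets R r x S then p r x S / (maxSets R r x S).card else 0

omit [Fintype α] in
theorem uniformAttention_eq (p : α → α → Finset α → ℝ) {R : α → α → Prop} (hR : LinOrd R)
    {r x : α} {D S : Finset α} (hD : D ∈ maxSets R r x S) :
    uniformAttention p R r D S = p r x S / (maxSets R r x S).card := by
  have hD' := Finset.mem_filter.1 hD
  have hx : x ∈ S := Finset.mem_powerset.1 hD'.1 hD'.2.2.1
  rw [uniformAttention, Finset.sum_eq_single_of_mem x hx, if_pos hD]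
  intro y _ hne
  refine if_neg fun hy => hne ?_
  exact hR.isMaxOf_unique (Finset.mem_filter.1 hy).2.2 hD'.2.2

omit [Fintype α] in
theorem exists_mem_maxSets {R : α → α → Prop} (hR : LinOrd R) {r : α} {D S : Finset α}
    (hr : r ∈ D) (hD : D ⊆ S) : ∃ x ∈ S, D ∈ maxSets R r x S := by
  obtain ⟨x, hx⟩ := hR.exists_isMaxOf ⟨r, hr⟩
  exact ⟨x, hD hx.1, Finset.mem_filter.2 ⟨Finset.mem_powerset.2 hD, hr, hx⟩⟩

omit [Fintype α] in
theorem sum_maxSets_div_card {p : α → α → Finset α → ℝ} (hp : IsRandomChoiceRule p)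
    {R : α → α → Prop} (hR : LinOrd R) {r x : α} {S : Finset α} (hr : r ∈ S) (hx : x ∈ S)
    (h : 0 < p r x S → R x r) :
    ∑ _D ∈ maxSets R r x S, p r x S / (maxSets R r x S).card = p r x S := by
  rw [Finset.sum_const, nsmul_eq_mul]
  rcases (hp.nonneg r x S).eq_or_lt with hzero | hpos
  · simp [← hzero]
  · have hmem : {x, r} ∈ maxSets R r x S := Finset.mem_filter.2
      ⟨by simp [Finset.insert_subset_iff, hr, hx], by simp, hR.isMaxOf_pair (h hpos)⟩
    have hcard : ((maxSets R r x S).card : ℝ) ≠ 0 :=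
      Nat.cast_ne_zero.2 (Finset.card_ne_zero_of_mem hmem)
    field_simp

omit [Fintype α] in
theorem isRDRAMRep_uniformAttention {p : α → α → Finset α → ℝ} (hp : IsRandomChoiceRule p)
    {R : α → α → Prop} (hR : LinOrd R)
    (hpos : ∀ r x (S : Finset α), r ∈ S → x ∈ S → (0 < p r x S ↔ R x r)) :
    IsRDRAMRep p R (uniformAttention p R) := by
  refine ⟨hR, fun r => ⟨⟨fun D S => ?_, fun S D _ _ h => ?_, fun S hne hr => ?_⟩, ?_⟩, ?_⟩
  · refine Finset.sum_nonneg fun x _ => ?_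
    split_ifs
    · exact div_nonneg (hp.nonneg r x S) (Nat.cast_nonneg _)
    · exact le_rfl
  · obtain ⟨x, -, hx⟩ := Finset.exists_ne_zero_of_sum_ne_zero h.ne'
    have hD := Finset.mem_filter.1 (ite_ne_right_iff.1 hx).1
    exact ⟨hD.2.1, Finset.mem_powerset.1 hD.1⟩
  · simp only [uniformAttention]
    rw [Finset.sum_comm, ← hp.sum_one r S hne hr]
    refine Finset.sum_congr rfl fun x hx => ?_
    rw [← Finset.sum_filter, Finset.filter_mem_eq_inter,
      Finset.inter_eq_right.2 (show maxSets R r x S ⊆ S.powerset from Finset.filter_subset _ _)]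
    exact sum_maxSets_div_card hp hR hr hx (hpos r x S hr hx).1
  · intro S D _ hr hrD hDS
    obtain ⟨x, hx, hD⟩ := exists_mem_maxSets hR hrD hDS
    rw [uniformAttention_eq p hR hD]
    exact div_pos ((hpos r x S hr hx).2 ((Finset.mem_filter.1 hD).2.2.2 r hrD))
      (Nat.cast_pos.2 (Finset.card_pos.2 ⟨D, hD⟩))
  · intro r S _ hr x hx
    rw [← sum_maxSets_div_card hp hR hr hx (hpos r x S hr hx).1]
    exact (Finset.sum_congr rfl fun D hD => uniformAttention_eq p hR hD).symm

/-- `p` has an RD-RAM representation iff it satisfies NCC, SQA, NRE. -/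
theorem rdram_characterization (h2 : 2 ≤ Fintype.card α)
    (p : α → α → Finset α → ℝ) (hp : IsRandomChoiceRule p) :
    (∃ (R : α → α → Prop) (μ : α → Finset α → Finset α → ℝ), IsRDRAMRep p R μ) ↔
      NCC p ∧ SQA p ∧ NRE p := by
  constructor
  · rintro ⟨R, μ, h⟩
    exact ⟨h.ncc hp, h.sqa, h.nre⟩
  · rintro ⟨hN, hS, hE⟩
    exact ⟨Dominates p, uniformAttention p (Dominates p),
      isRDRAMRep_uniformAttention hp (linOrd_dominates hp hN hS hE)
        fun _ _ _ hr hx => pos_iff_dominates hp hN hS hE hr hx⟩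

end
end RDRAM
end

section
/- If (⪰,{μ_r}_{r∈X}) and (⪰',{μ'_r}_{r∈X}) are two RD-RAM representations of the same reference-dependent random choice rule {p_r}_{r∈X}, then ⪰ = ⪰'. -/
open Finset
open scoped Classical

namespace RDRAM

noncomputable section

variable {α : Type*} [Fintype α] [DecidableEq α]

/-- The preference is revealed by binary menus: `x` is weakly preferred to `y` iff `x` is chosen
with positive probability from `{y, x}` at reference `y`. -/
theorem IsRDRAMRep.rel_iff_pos {p : α → α → Finset α → ℝ} {R : α → α → Prop}
    {μ : α → Finset α → Finset α → ℝ} (h : IsRDRAMRep p R μ) (x y : α) :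
    R x y ↔ 0 < p y x {y, x} := by
  obtain ⟨hR, hμ, hp⟩ := h
  have hne : ({y, x} : Finset α).Nonempty := ⟨y, by simp⟩
  rw [hp y {y, x} hne (by simp) x (by simp)]
  constructor
  · intro hxy
    refine Finset.sum_pos' (fun D _ => (hμ y).1.nonneg D _) ⟨{y, x}, ?_, ?_⟩
    · have hxx : R x x := (hR.total x x).elim id id
      refine Finset.mem_filter.2 ⟨by simp, by simp, by simp, fun z hz => ?_⟩
      rcases Finset.mem_insert.1 hz with rfl | hz
      · exact hxy
      · exact Finset.mem_singleton.1 hz ▸ hxx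
    · exact (hμ y).2 _ _ hne (by simp) (by simp) subset_rfl
  · intro hpos
    obtain ⟨D, hD, -⟩ := Finset.exists_ne_zero_of_sum_ne_zero hpos.ne'
    obtain ⟨-, hyD, -, hmax⟩ := Finset.mem_filter.1 hD
    exact hmax y hyD

/-- the preference in an RD-RAM representation is unique. -/
theorem rdram_preference_unique (h2 : 2 ≤ Fintype.card α)
    (p : α → α → Finset α → ℝ) (hp : IsRandomChoiceRule p)
    {R R' : α → α → Prop} {μ μ' : α → Finset α → Finset α → ℝ}
    (h1 : IsRDRAMRep p R μ) (h2' : IsRDRAMRep p R' μ') : R = R' := by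
  funext x y
  exact propext ((h1.rel_iff_pos x y).trans (h2'.rel_iff_pos x y).symm)

end
end RDRAM
end

section
/- If (⪰,{γ_r}_{r∈X}) and (⪰',{γ'_r}_{r∈X}) are two IRA representations of the same reference-dependent random choice rule {p_r}_{r∈X}, then ⪰ = ⪰' and γ_r(x) = γ'_r(x) for every r ∈ X and every x ∈ X with x ⪰ r. -/
open Finset
open scoped Classical

namespace RDRAM

noncomputable section

variable {α : Type*} [Fintype α] [DecidableEq α]

theorem choice_pair_of_rel {p : α → α → Finset α → ℝ} {R : α → α → Prop} {γ : α → α → ℝ}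
    (h : IsIRAPair p R γ) {r x : α} (hx : R x r) : p r x {r, x} = γ r x := by
  obtain ⟨hR, hγ, hp⟩ := h
  have hfilter : ({r, x} : Finset α).powerset.filter (fun D => r ∈ D ∧ IsMaxOf R x D)
      = {{r, x}} := by
    ext D
    rw [mem_filter, mem_powerset, mem_singleton]
    constructor
    · rintro ⟨hD, hrD, hxD, -⟩
      exact hD.antisymm (insert_subset hrD (singleton_subset_iff.2 hxD))
    · rintro rfl
      simpa [IsMaxOf] using ⟨hx, (hR.total x x).elim id id⟩
  rw [hp r {r, x} (by simp) (by simp) x (by simp), hfilter, sum_singleton, sdiff_self]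
  rcases eq_or_ne r x with rfl | hrx
  · simp [(hγ r).1]
  · simp [prod_pair hrx, (hγ r).1]

theorem choice_pair_of_not_rel {p : α → α → Finset α → ℝ} {R : α → α → Prop} {γ : α → α → ℝ}
    (h : IsIRAPair p R γ) {r x : α} (hx : ¬ R x r) : p r x {r, x} = 0 := by
  rw [h.2.2 r {r, x} (by simp) (by simp) x (by simp)]
  refine sum_eq_zero fun D hD => ?_
  obtain ⟨-, hrD, hmax⟩ := mem_filter.1 hD
  exact absurd (hmax.2 r hrD) hx

theorem attention_pos {p : α → α → Finset α → ℝ} {R : α → α → Prop} {γ : α → α → ℝ}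
    (h : IsIRAPair p R γ) (r x : α) : 0 < γ r x := by
  rcases eq_or_ne x r with rfl | hxr
  · simp [(h.2.1 x).1]
  · exact ((h.2.1 r).2 x hxr).1

theorem rel_iff_choice_pair_pos {p : α → α → Finset α → ℝ} {R : α → α → Prop}
    {γ : α → α → ℝ} (h : IsIRAPair p R γ) (r x : α) : R x r ↔ 0 < p r x {r, x} := by
  refine ⟨fun hx => choice_pair_of_rel h hx ▸ attention_pos h r x, fun hpos => ?_⟩
  by_contra hx
  exact hpos.ne' (choice_pair_of_not_rel h hx)

/-- uniqueness of preference and of attention maps on the upper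
contour set of the reference, in the IRA model. -/
theorem ira_uniqueness (h2 : 2 ≤ Fintype.card α)
    (p : α → α → Finset α → ℝ) (hp : IsRandomChoiceRule p)
    {R R' : α → α → Prop} {γ γ' : α → α → ℝ}
    (h1 : IsIRAPair p R γ) (h2' : IsIRAPair p R' γ') :
    R = R' ∧ ∀ r x : α, R x r → γ r x = γ' r x := by
  obtain rfl : R = R' := by
    ext x r
    rw [rel_iff_choice_pair_pos h1, rel_iff_choice_pair_pos h2']
  exact ⟨rfl, fun r x hx => (choice_pair_of_rel h1 hx).symm.trans (choice_pair_of_rel h2' hx)⟩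

end
end RDRAM
end

section
/- Suppose {p_r}_{r∈X} has an RD-RAM representation (⪰,{μ_r}) in which {μ_r}_{r∈X} has a reference-independent CRA representation. Then {p_r}_{r∈X} satisfies strict Status Quo Monotonicity: for every menu S and all distinct r,x ∈ S, p_x(x,S) > p_r(x,S). -/
open Finset
open scoped Classical

namespace RDRAM

noncomputable section

variable {α : Type*} [Fintype α] [DecidableEq α]

/-- Summing `f D + f (D.erase r)` over the sets `D` containing `r` sums `f` over all sets. -/
theorem sum_mem_add_erase (r : α) (f : Finset α → ℝ) :
    ∑ D with r ∈ D, (f D + f (D.erase r)) = ∑ E, f E := by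
  rw [sum_add_distrib, ← sum_filter_add_sum_filter_not univ (fun E => r ∈ E) f]
  congr 1
  refine sum_bij' (fun D _ => D.erase r) (fun E _ => insert r E) ?_ ?_ ?_ ?_ ?_ <;>
    simp +contextual

/-- Under a reference-independent CRA with weights `π`, the agent with reference `r` facing `S`
draws a set `E` from `π` and considers `insert r (E ∩ S)`. -/
theorem choiceProb_eq_sum_insert {p : α → α → Finset α → ℝ} {R : α → α → Prop}
    {μ : α → Finset α → Finset α → ℝ} (hrd : IsRDRAMRep p R μ) {π : Finset α → ℝ}
    (hπ : ∀ r (S : Finset α), S.Nonempty → r ∈ S → ∀ D : Finset α, r ∈ D → D ⊆ S →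
      μ r D S = ∑ D' ∈ (univ : Finset α).powerset.filter (fun D' => D' ∩ S = D),
        (π D' + π (D'.erase r)))
    {S : Finset α} {r x : α} (hr : r ∈ S) (hx : x ∈ S) :
    p r x S = ∑ E, if IsMaxOf R x (insert r (E ∩ S)) then π E else 0 := by
  rw [hrd.2.2 r S ⟨r, hr⟩ hr x hx, ← sum_mem_add_erase r]
  have hins (D : Finset α) (hD : r ∈ D) : insert r (D ∩ S) = D ∩ S :=
    insert_eq_of_mem (mem_inter.2 ⟨hD, hr⟩)
  have hers (D : Finset α) (hD : r ∈ D) : insert r (D.erase r ∩ S) = D ∩ S := by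
    rw [← insert_inter_of_mem hr, insert_erase hD]
  calc
    _ = ∑ D ∈ S.powerset.filter (fun D => r ∈ D ∧ IsMaxOf R x D),
        ∑ D' ∈ univ.filter (fun D' => r ∈ D' ∧ IsMaxOf R x (D' ∩ S)) with D' ∩ S = D,
          (π D' + π (D'.erase r)) := by
      refine sum_congr rfl fun D hD => ?_
      obtain ⟨hDS, hrD, hmax⟩ := by simpa using hD
      rw [hπ r S ⟨r, hr⟩ hr D hrD hDS]
      refine sum_congr ?_ fun _ _ => rfl
      ext D'
      simp only [mem_filter, powerset_univ, mem_univ, true_and]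
      refine ⟨fun h => ⟨⟨?_, h ▸ hmax⟩, h⟩, fun h => h.2⟩
      exact (mem_inter.1 (h ▸ hrD : r ∈ D' ∩ S)).1
    _ = ∑ D' with r ∈ D' ∧ IsMaxOf R x (D' ∩ S), (π D' + π (D'.erase r)) := by
      refine sum_fiberwise_of_maps_to (fun D' hD' => ?_) _
      obtain ⟨hrD, hmax⟩ := by simpa using hD'
      simpa [hr, hrD] using hmax
    _ = _ := by
      rw [← filter_filter, sum_filter]
      refine sum_congr rfl fun D hD => ?_
      have hrD : r ∈ D := by simpa using hD
      rw [hins D hrD, hers D hrD]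
      split_ifs <;> simp

/-- a reference-independent CRA satisfies strict Status Quo Monotonicity. -/
theorem refIndepCRA_sqm (h2 : 2 ≤ Fintype.card α)
    (p : α → α → Finset α → ℝ) (hp : IsRandomChoiceRule p)
    {R : α → α → Prop} {μ : α → Finset α → Finset α → ℝ}
    (hrd : IsRDRAMRep p R μ) (hci : RefIndepCRA μ) :
    ∀ S : Finset α, S.Nonempty → ∀ r ∈ S, ∀ x ∈ S, r ≠ x → p r x S < p x x S := by
  intro S _ r hr x hx hne
  obtain ⟨π, hπ0, hπpos, -, hπ⟩ := hci
  have hrefl (y : α) : R y y := or_self_iff.1 (hrd.1.total y y)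
  have hnonneg (E : Finset α) : 0 ≤ π E := by
    obtain rfl | hE := E.eq_empty_or_nonempty
    exacts [hπ0.ge, (hπpos E hE).le]
  have himp (E : Finset α) (h : IsMaxOf R x (insert r (E ∩ S))) :
      IsMaxOf R x (insert x (E ∩ S)) := by
    refine ⟨mem_insert_self _ _, fun y hy => ?_⟩
    obtain rfl | hy := mem_insert.1 hy
    exacts [hrefl y, h.2 y (mem_insert_of_mem hy)]
  obtain ⟨E, hE, hEx, hEr⟩ : ∃ E : Finset α, E.Nonempty ∧
      IsMaxOf R x (insert x (E ∩ S)) ∧ ¬ IsMaxOf R x (insert r (E ∩ S)) := by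
    by_cases hxr : R x r
    · exact ⟨{r}, by simp, by simp [IsMaxOf, hr, hrefl, hxr], by simp [IsMaxOf, hr, hne.symm]⟩
    · exact ⟨{x}, by simp, by simp [IsMaxOf, hx, hrefl], by simp [IsMaxOf, hxr]⟩
  rw [choiceProb_eq_sum_insert hrd hπ hr hx, choiceProb_eq_sum_insert hrd hπ hx hx]
  refine sum_lt_sum (fun E _ => ?_) ⟨E, mem_univ E, ?_⟩
  · by_cases h : IsMaxOf R x (insert r (E ∩ S))
    · simp [h, himp E h]
    · rw [if_neg h]
      split_ifs
      exacts [hnonneg E, le_rfl]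
  · simpa [hEx, hEr] using hπpos E hE

end
end RDRAM
end

section
/- Every stochastic choice rule is an RD-RAM without full support with random reference: for every stochastic choice rule p there exist a linear order ⪰ on X, a family of random attention rules {μ_r}_{r∈X} (not required to have full support), and a map η with η(r,S) ≥ 0, η(r,S) > 0 only if r ∈ S, and Σ_{r∈S} η(r,S) = 1 for every menu S, such that for every menu S and every x ∈ S, p(x,S) = Σ_{r∈S} p_r(x,S)·η(r,S), where p_r(x,S) = Σ_{D : r ∈ D ⊆ S and x is the ⪰-maximum of D} μ_r(D,S). -/
open Finset
open scoped Classical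

namespace RDRAM

noncomputable section

variable {α : Type*} [Fintype α] [DecidableEq α]

/-- every stochastic choice rule is an RD-RAM (without full
support) with random reference. -/
theorem scr_is_rdram_with_random_reference (h2 : 2 ≤ Fintype.card α)
    (q : α → Finset α → ℝ) (hq : IsStochasticChoiceRule q) :
    ∃ (R : α → α → Prop) (μ : α → Finset α → Finset α → ℝ) (η : α → Finset α → ℝ),
      LinOrd R ∧ (∀ r, IsAttentionRule r (μ r)) ∧
      (∀ r S, 0 ≤ η r S) ∧ (∀ r (S : Finset α), 0 < η r S → r ∈ S) ∧
      (∀ S : Finset α, S.Nonempty → ∑ r ∈ S, η r S = 1) ∧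
      ∀ S : Finset α, S.Nonempty → ∀ x ∈ S,
        q x S = ∑ r ∈ S,
          (∑ D ∈ S.powerset.filter (fun D => r ∈ D ∧ IsMaxOf R x D), μ r D S) * η r S := by
  let e := Fintype.equivFin α
  refine ⟨fun x y => e y ≤ e x, fun r D _ => if D = {r} then 1 else 0,
    fun r S => if r ∈ S then q r S else 0, ?_, ?_, ?_, ?_, ?_, ?_⟩
  · exact ⟨fun x y => le_total _ _, fun x y hxy hyx => e.injective (le_antisymm hyx hxy),
      fun x y z hxy hyz => hyz.trans hxy⟩
  · intro r
    refine ⟨fun D S => ?_, fun S D _ hr hD => ?_, fun S _ hr => ?_⟩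
    · dsimp only
      split_ifs <;> norm_num
    · have hD' : D = {r} := by
        by_contra hne
        simp [hne] at hD
      simp [hD', hr]
    · simp [Finset.sum_ite_eq', hr]
  · intro r S
    dsimp only
    split_ifs
    · exact hq.nonneg r S
    · exact le_rfl
  · intro r S h
    by_contra hr
    simp [hr] at h
  · intro S hS
    rw [← hq.sum_one S hS]
    exact Finset.sum_congr rfl fun r hr => if_pos hr
  · intro S hS x hx
    rw [Finset.sum_eq_single_of_mem x hx]
    · simp [IsMaxOf, hx]
    · intro r hr hrx
      refine mul_eq_zero_of_left (Finset.sum_eq_zero fun D hD => if_neg ?_) _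
      rintro rfl
      exact hrx (Finset.mem_singleton.mp (Finset.mem_filter.mp hD).2.2.1).symm

end
end RDRAM
end

section
/- If the reference-dependent random choice rule {p_r}_{r∈X} has a CRA representation, then it has an RD-RUM (Reference-Dependent Random Utility Model) representation: for each r ∈ X there is a probability distribution π'_r on the set of linear orders on X such that for every menu S with r ∈ S and every x ∈ S, p_r(x,S) = Σ_{⪰' : x is the ⪰'-maximum of S} π'_r(⪰'). -/
open Finset
open scoped Classical

namespace RDRAM

noncomputable section

variable {α : Type*} [Fintype α] [DecidableEq α]

/-- The order `R` modified so that every element of `D` is ranked above every element outside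
`D`. -/
def promote (R : α → α → Prop) (D : Finset α) (x y : α) : Prop :=
  (x ∈ D ∧ y ∉ D) ∨ ((x ∈ D ↔ y ∈ D) ∧ R x y)

theorem LinOrd.promote {β : Type*} {R : β → β → Prop} (hR : LinOrd R) (D : Finset β) :
    LinOrd (promote R D) where
  total x y := by
    have := hR.total x y
    unfold RDRAM.promote
    tauto
  antisymm x y h h' := by
    have := hR.antisymm x y
    unfold RDRAM.promote at h h'
    tauto
  trans x y z h h' := by
    have := hR.trans x y z
    unfold RDRAM.promote at h h' ⊢
    tauto

theorem isMaxOf_promote_iff {β : Type*} [DecidableEq β] {R : β → β → Prop} {D S : Finset β}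
    {r x : β} (hrD : r ∈ D) (hrS : r ∈ S) :
    IsMaxOf (promote R D) x S ↔ IsMaxOf R x (D ∩ S) := by
  unfold IsMaxOf promote
  constructor
  · rintro ⟨hxS, h⟩
    have hxD : x ∈ D := by
      have := h r hrS
      tauto
    refine ⟨mem_inter.2 ⟨hxD, hxS⟩, fun y hy => ?_⟩
    have := h y (mem_inter.1 hy).2
    have := (mem_inter.1 hy).1
    tauto
  · rintro ⟨hx, h⟩
    obtain ⟨hxD, hxS⟩ := mem_inter.1 hx
    refine ⟨hxS, fun y hy => ?_⟩
    by_cases hyD : y ∈ D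
    · exact Or.inr ⟨by tauto, h y (mem_inter.2 ⟨hyD, hy⟩)⟩
    · exact Or.inl ⟨hxD, hyD⟩

/-- Summing the push-forward of a weight along `f` over the values satisfying `P`. -/
theorem sum_filter_pushforward {ι κ : Type*} [Fintype κ] [DecidableEq κ] (A : Finset ι) (f : ι → κ)
    (w : ι → ℝ) (P : κ → Prop) [DecidablePred P] :
    ∑ k ∈ univ.filter P, ∑ i ∈ A.filter (fun i => f i = k), w i =
      ∑ i ∈ A.filter (fun i => P (f i)), w i := by
  rw [← sum_fiberwise_of_maps_to (s := A.filter fun i => P (f i)) (t := univ.filter P) (g := f)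
    (fun i hi => mem_filter.2 ⟨mem_univ _, (mem_filter.1 hi).2⟩)]
  refine sum_congr rfl fun k hk => sum_congr ?_ fun _ _ => rfl
  have hk := (mem_filter.1 hk).2
  ext i
  simp only [mem_filter]
  constructor
  · rintro ⟨hi, rfl⟩
    exact ⟨⟨hi, hk⟩, rfl⟩
  · rintro ⟨⟨hi, -⟩, h⟩
    exact ⟨hi, h⟩

/-- a CRA representation implies a reference-dependent random
utility (RD-RUM) representation. -/
theorem cra_implies_rdrum (h2 : 2 ≤ Fintype.card α)
    (p : α → α → Finset α → ℝ) (hp : IsRandomChoiceRule p)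
    (hcra : HasCRARep p) :
    ∃ ν : α → (α → α → Prop) → ℝ,
      ∀ r : α, (∀ R, 0 ≤ ν r R) ∧ (∀ R, ¬ LinOrd R → ν r R = 0) ∧
        (∑ R ∈ (univ : Finset (α → α → Prop)).filter (fun R => LinOrd R), ν r R) = 1 ∧
        ∀ S : Finset α, S.Nonempty → r ∈ S → ∀ x ∈ S,
          p r x S = ∑ R ∈ (univ : Finset (α → α → Prop)).filter
            (fun R => LinOrd R ∧ IsMaxOf R x S), ν r R := by
  obtain ⟨R, μ, ⟨hR, -, hpμ⟩, hμ⟩ := hcra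
  choose π hpos hsum hμπ using hμ
  refine ⟨fun r R' => ∑ D ∈ ((univ : Finset α).powerset.filter (fun D => r ∈ D)).filter
    (fun D => promote R D = R'), π r D, fun r => ⟨?_, ?_, ?_, ?_⟩⟩
  · intro R'
    exact sum_nonneg fun D hD => (hpos r D (mem_filter.1 (mem_filter.1 hD).1).2).le
  · intro R' hR'
    refine sum_eq_zero fun D hD => absurd ?_ hR'
    exact (mem_filter.1 hD).2 ▸ hR.promote D
  · beta_reduce
    rw [sum_filter_pushforward, ← hsum r]
    exact sum_congr (filter_true_of_mem fun D _ => hR.promote D) fun _ _ => rfl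
  · intro S hS hr x hx
    beta_reduce
    rw [sum_filter_pushforward, hpμ r S hS hr x hx]
    rw [← sum_fiberwise_of_maps_to (f := π r) (g := fun D => D ∩ S)
      (t := S.powerset.filter (fun D => r ∈ D ∧ IsMaxOf R x D))]
    · refine sum_congr rfl fun D hD => ?_
      obtain ⟨hDS, hrD, hmax⟩ := mem_filter.1 hD
      rw [hμπ r S hS hr D hrD (mem_powerset.1 hDS)]
      refine sum_congr ?_ fun _ _ => rfl
      ext D'
      simp only [mem_filter, powerset_univ, mem_univ, true_and]
      constructor
      · rintro rfl
        have hrD' := (mem_inter.1 hrD).1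
        exact ⟨⟨hrD', hR.promote D', (isMaxOf_promote_iff hrD' hr).2 hmax⟩, rfl⟩
      · exact fun h => h.2
    · intro D' hD'
      obtain ⟨hD', -, hmax⟩ := mem_filter.1 hD'
      have hrD' := (mem_filter.1 hD').2
      exact mem_filter.2 ⟨mem_powerset.2 inter_subset_right, mem_inter.2 ⟨hrD', hr⟩,
        (isMaxOf_promote_iff hrD' hr).1 hmax⟩

end
end RDRAM
end

section
/- If (⪰,{μ_r}_{r∈X}) is an RD-RAM representation of the reference-dependent random choice rule {p_r}_{r∈X}, then for all distinct x,y ∈ X the following are equivalent: (i) x ≻ y (x ⪰ y and x ≠ y); (ii) p_y(x,T) > 0 for some menu T containing x and y; (iii) p_y(x,T) > 0 for every menu T containing x and y. -/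
open Finset
open scoped Classical

namespace RDRAM

noncomputable section

variable {α : Type*} [Fintype α] [DecidableEq α]

/-- in an RD-RAM, strict revealed preference coincides with being
chosen with positive probability against the other as reference, in some menu
or equivalently in every menu. -/
theorem revealed_preference_tfae (h2 : 2 ≤ Fintype.card α)
    (p : α → α → Finset α → ℝ) (hp : IsRandomChoiceRule p)
    {R : α → α → Prop} {μ : α → Finset α → Finset α → ℝ}
    (hrd : IsRDRAMRep p R μ) :
    ∀ x y : α, x ≠ y →
      (R x y ↔ ∃ T : Finset α, x ∈ T ∧ y ∈ T ∧ 0 < p y x T) ∧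
      (R x y ↔ ∀ T : Finset α, x ∈ T → y ∈ T → 0 < p y x T) := by
  obtain ⟨hR, hμ, hp_eq⟩ := hrd
  intro x y _
  have pos_of_rel (hxy : R x y) (T : Finset α) (hx : x ∈ T) (hy : y ∈ T) : 0 < p y x T := by
    rw [hp_eq y T ⟨y, hy⟩ hy x hx]
    refine Finset.sum_pos' (fun D _ => (hμ y).1.nonneg D T) ⟨{x, y}, ?_, ?_⟩
    · have hxx : R x x := (hR.total x x).elim id id
      refine Finset.mem_filter.2 ⟨?_, ?_⟩
      · simp [Finset.insert_subset_iff, hx, hy]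
      · simp [IsMaxOf, hxx, hxy]
    · exact (hμ y).2 T {x, y} ⟨y, hy⟩ hy (by simp) (by simp [Finset.insert_subset_iff, hx, hy])
  have rel_of_pos (T : Finset α) (hx : x ∈ T) (hy : y ∈ T) (hpos : 0 < p y x T) : R x y := by
    rw [hp_eq y T ⟨y, hy⟩ hy x hx] at hpos
    obtain ⟨D, hD, -⟩ := Finset.exists_ne_zero_of_sum_ne_zero hpos.ne'
    obtain ⟨-, hyD, -, hmax⟩ := Finset.mem_filter.1 hD
    exact hmax y hyD
  refine ⟨⟨fun hxy => ⟨{x, y}, by simp, by simp, pos_of_rel hxy _ (by simp) (by simp)⟩,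
    fun ⟨T, hx, hy, hpos⟩ => rel_of_pos T hx hy hpos⟩, pos_of_rel, fun hall => ?_⟩
  exact rel_of_pos {x, y} (by simp) (by simp) (hall _ (by simp) (by simp))

end
end RDRAM
end
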